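/- Let s, t be real numbers with |t − s| > 1, and let α = min{s, t}. Then the function −Θ_{s,t}(x), where Θ_{s,t}(x) = [ψ(x+t) − ψ(x+s)]² + (t − s)[ψ'(x+t) − ψ'(x+s)], is completely monotonic on the interval (−α, ∞). -/

import Mathlib

/-- The digamma function `ψ = Γ'/Γ`, as the derivative of `log ∘ Γ`. -/
noncomputable def digamma (x : ℝ) : ℝ := deriv (fun y : ℝ => Real.log (Real.Gamma y)) x

/-- The trigamma function `ψ'`. -/
noncomputable def trigamma (x : ℝ) : ℝ := deriv digamma x

section

open Set Filter Topology
open scoped ContDiff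

/-- Complete monotonicity on `(0, ∞)`. -/
def IsCompletelyMonotone (f : ℝ → ℝ) : Prop :=
  ContDiffOn ℝ ∞ f (Ioi 0) ∧ ∀ n : ℕ, ∀ x ∈ Ioi (0 : ℝ), 0 ≤ (-1 : ℝ) ^ n * iteratedDeriv n f x

theorem ContDiffOn.deriv_Ioi {f : ℝ → ℝ} (hf : ContDiffOn ℝ ∞ f (Ioi 0)) :
    ContDiffOn ℝ ∞ (deriv f) (Ioi 0) :=
  ((contDiffOn_infty_iff_deriv_of_isOpen isOpen_Ioi).1 hf).2

theorem ContDiffOn.comp_add_const_Ioi {f : ℝ → ℝ} (hf : ContDiffOn ℝ ∞ f (Ioi 0)) {c : ℝ}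
    (hc : 0 ≤ c) : ContDiffOn ℝ ∞ (fun x => f (x + c)) (Ioi 0) :=
  hf.comp (contDiff_id.add contDiff_const).contDiffOn fun _ hx => add_pos_of_pos_of_nonneg hx hc

theorem ContDiffOn.contDiffAt_of_pos {f : ℝ → ℝ} (hf : ContDiffOn ℝ ∞ f (Ioi 0)) {x : ℝ}
    (hx : 0 < x) : ContDiffAt ℝ ∞ f x :=
  hf.contDiffAt (Ioi_mem_nhds hx)

theorem ContDiffOn.differentiableAt_of_pos {f : ℝ → ℝ} (hf : ContDiffOn ℝ ∞ f (Ioi 0)) {x : ℝ}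
    (hx : 0 < x) : DifferentiableAt ℝ f x :=
  (hf.contDiffAt_of_pos hx).differentiableAt (by simp)

/-- A real function whose forward differences are nonpositive and which tends to zero is
nonnegative. -/
theorem nonneg_of_shift_le_of_tendsto {u : ℝ → ℝ} (hu : ∀ x ≥ 0, u (x + 1) ≤ u x)
    (h0 : Tendsto u atTop (𝓝 0)) : 0 ≤ u 0 := by
  have hanti : Antitone fun n : ℕ => u n := antitone_nat_of_succ_le fun n => by
    simpa using hu n n.cast_nonneg
  simpa using hanti.le_of_tendsto (h0.comp tendsto_natCast_atTop_atTop) 0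

namespace IsCompletelyMonotone

variable {f g : ℝ → ℝ}

theorem congr (hf : IsCompletelyMonotone f) (h : EqOn g f (Ioi 0)) : IsCompletelyMonotone g := by
  refine ⟨hf.1.congr h, fun n x hx => ?_⟩
  rw [(h.eventuallyEq_of_mem (Ioi_mem_nhds hx)).iteratedDeriv_eq]
  exact hf.2 n x hx

theorem neg_deriv (hf : IsCompletelyMonotone f) : IsCompletelyMonotone fun x => -deriv f x := by
  refine ⟨hf.1.deriv_Ioi.neg, fun n x hx => ?_⟩
  have := hf.2 (n + 1) x hx
  rw [iteratedDeriv_succ'] at this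
  rw [iteratedDeriv_fun_neg]
  linarith [pow_succ (-1 : ℝ) n ▸ this]

theorem const_mul (hf : IsCompletelyMonotone f) {c : ℝ} (hc : 0 ≤ c) :
    IsCompletelyMonotone fun x => c * f x := by
  refine ⟨contDiffOn_const.mul hf.1, fun n x hx => ?_⟩
  rw [iteratedDeriv_const_mul_field, mul_left_comm]
  exact mul_nonneg hc (hf.2 n x hx)

theorem mul (hf : IsCompletelyMonotone f) (hg : IsCompletelyMonotone g) :
    IsCompletelyMonotone fun x => f x * g x := by
  refine ⟨hf.1.mul hg.1, fun n x hx => ?_⟩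
  rw [iteratedDeriv_fun_mul ((hf.1.contDiffAt_of_pos hx).of_le (by exact_mod_cast le_top))
    ((hg.1.contDiffAt_of_pos hx).of_le (by exact_mod_cast le_top)), Finset.mul_sum]
  refine Finset.sum_nonneg fun i hi => ?_
  have hin : i ≤ n := Nat.lt_succ_iff.1 (Finset.mem_range.1 hi)
  have hpow : (-1 : ℝ) ^ n = (-1) ^ i * (-1) ^ (n - i) := by
    rw [← pow_add, Nat.add_sub_cancel' hin]
  have := mul_nonneg (Nat.cast_nonneg (α := ℝ) (n.choose i))
    (mul_nonneg (hf.2 i x hx) (hg.2 (n - i) x hx))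
  rw [hpow]
  linarith

theorem inv_add_const {c : ℝ} (hc : 0 ≤ c) : IsCompletelyMonotone fun x => (x + c)⁻¹ := by
  have hpos : ∀ x ∈ Ioi (0 : ℝ), 0 < x + c := fun x hx => add_pos_of_pos_of_nonneg hx hc
  refine ⟨(contDiff_id.add contDiff_const).contDiffOn.inv fun x hx => (hpos x hx).ne',
    fun n x hx => ?_⟩
  have h := congrFun (iteratedDeriv_comp_add_const n (fun x : ℝ => x⁻¹) c) x
  rw [h, iteratedDeriv_eq_iterate, iter_deriv_inv, ← mul_assoc, ← mul_assoc, ← mul_pow]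
  have := zpow_pos (hpos x hx) (-1 - (n : ℤ))
  simp only [mul_neg, mul_one, neg_neg, one_pow, one_mul]
  positivity

theorem convexOn (hf : IsCompletelyMonotone f) : ConvexOn ℝ (Ioi 0) f := by
  refine convexOn_of_deriv2_nonneg' (convex_Ioi 0) (hf.1.differentiableOn (by simp))
    (hf.1.deriv_Ioi.differentiableOn (by simp)) fun x hx => ?_
  simpa [iteratedDeriv_eq_iterate] using hf.2 2 x hx

end IsCompletelyMonotone

section Telescoping

variable {f : ℝ → ℝ}

theorem convexOn_of_sub_shift (hΔ : ConvexOn ℝ (Ioi 0) fun x => f x - f (x + 1))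
    (h0 : Tendsto f atTop (𝓝 0)) : ConvexOn ℝ (Ioi 0) f := by
  refine ⟨convex_Ioi 0, fun x hx y hy a b ha hb hab => ?_⟩
  have hx' : 0 < x := hx
  have hy' : 0 < y := hy
  have htend : ∀ c : ℝ, Tendsto (fun s => f (c + s)) atTop (𝓝 0) := fun c =>
    h0.comp (tendsto_atTop_add_const_left _ c tendsto_id)
  have hlim := (((htend x).const_mul a).add ((htend y).const_mul b)).sub (htend (a * x + b * y))
  have key := nonneg_of_shift_le_of_tendsto
    (u := fun s => a * f (x + s) + b * f (y + s) - f (a * x + b * y + s)) (fun s hs => ?_)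
    (by simpa using hlim)
  · simpa using key
  · have h := hΔ.2 (x := x + s) (mem_Ioi.2 (by positivity)) (y := y + s)
      (mem_Ioi.2 (by positivity)) ha hb hab
    have hs' : a * (x + s) + b * (y + s) = a * x + b * y + s := by
      linear_combination s * hab
    simp only [smul_eq_mul, hs'] at h
    simp only [← add_assoc]
    linarith

theorem tendsto_deriv_of_convexOn (hc : ConvexOn ℝ (Ioi 0) f)
    (hd : ∀ x ∈ Ioi (0 : ℝ), DifferentiableAt ℝ f x) (h0 : Tendsto f atTop (𝓝 0)) :
    Tendsto (deriv f) atTop (𝓝 0) := by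
  have h1 : Tendsto (fun x => f x - f (x - 1)) atTop (𝓝 0) := by
    simpa [← sub_eq_add_neg] using h0.sub (h0.comp (tendsto_atTop_add_const_right _ (-1) tendsto_id))
  have h2 : Tendsto (fun x => f (x + 1) - f x) atTop (𝓝 0) := by
    simpa using (h0.comp (tendsto_atTop_add_const_right _ 1 tendsto_id)).sub h0
  refine tendsto_of_tendsto_of_tendsto_of_le_of_le' h1 h2 ?_ ?_ <;>
    filter_upwards [eventually_gt_atTop 1] with x hx
  · have := hc.slope_le_deriv (x := x - 1) (y := x) (mem_Ioi.2 (by linarith))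
      (mem_Ioi.2 (by linarith)) (by linarith) (hd x (mem_Ioi.2 (by linarith)))
    simpa [slope_def_field] using this
  · have := hc.deriv_le_slope (x := x) (y := x + 1) (mem_Ioi.2 (by linarith))
      (mem_Ioi.2 (by linarith)) (by linarith) (hd x (mem_Ioi.2 (by linarith)))
    simpa [slope_def_field] using this

theorem tendsto_deriv_of_sub_shift (hf : ContDiffOn ℝ ∞ f (Ioi 0))
    (hΔ : IsCompletelyMonotone fun x => f x - f (x + 1)) (h0 : Tendsto f atTop (𝓝 0)) :
    Tendsto (deriv f) atTop (𝓝 0) :=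
  tendsto_deriv_of_convexOn (convexOn_of_sub_shift hΔ.convexOn h0)
    (fun _ hx => hf.differentiableAt_of_pos hx) h0

/-- A smooth function tending to zero at infinity is completely monotonic as soon as
`f x - f (x + 1)` is. -/
theorem IsCompletelyMonotone.of_sub_shift (hf : ContDiffOn ℝ ∞ f (Ioi 0))
    (hΔ : IsCompletelyMonotone fun x => f x - f (x + 1)) (h0 : Tendsto f atTop (𝓝 0)) :
    IsCompletelyMonotone f := by
  refine ⟨hf, fun n => ?_⟩
  induction n generalizing f with
  | zero =>
    intro x hx
    have key := nonneg_of_shift_le_of_tendsto (u := fun s => f (x + s)) (fun s hs => ?_)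
      (h0.comp (tendsto_atTop_add_const_left _ x tendsto_id))
    · simpa using key
    · have := hΔ.2 0 (x + s) (add_pos_of_pos_of_nonneg hx hs)
      simp only [pow_zero, iteratedDeriv_zero, one_mul] at this
      rw [← add_assoc]
      linarith
  | succ n ih =>
    intro x hx
    have h := ih (f := fun x => -deriv f x) hf.deriv_Ioi.neg
      (hΔ.neg_deriv.congr fun y hy => ?_)
      (by simpa using (tendsto_deriv_of_sub_shift hf hΔ h0).neg) x hx
    · rw [iteratedDeriv_fun_neg] at h
      rw [iteratedDeriv_succ', pow_succ]
      linarith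
    · have hy1 : 0 < y + 1 := add_pos hy one_pos
      have hd := hf.differentiableAt_of_pos hy1
      simp only
      rw [deriv_fun_sub (hf.differentiableAt_of_pos hy)
        (differentiableAt_comp_add_const.2 hd), deriv_comp_add_const]
      ring

end Telescoping

section Digamma

theorem contDiffOn_log_Gamma : ContDiffOn ℝ ∞ (fun x => Real.log (Real.Gamma x)) (Ioi 0) := by
  intro x hx
  have hopen : IsOpen {z : ℂ | 0 < z.re} := isOpen_lt continuous_const Complex.continuous_re
  have hd : DifferentiableOn ℂ Complex.Gamma {z : ℂ | 0 < z.re} := fun z hz =>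
    (Complex.differentiableAt_Gamma z fun m hm => by
      have hz' : 0 < z.re := hz
      have : (0 : ℝ) ≤ m := m.cast_nonneg
      simp only [hm, Complex.neg_re, Complex.natCast_re] at hz'
      linarith).differentiableWithinAt
  have ha : AnalyticAt ℂ Complex.Gamma (x : ℂ) :=
    hd.analyticAt (hopen.mem_nhds (by simpa using hx))
  have hc : ContDiffAt ℝ ∞ Real.Gamma x := ha.re_ofReal.contDiffAt
  exact (hc.log (Real.Gamma_pos_of_pos hx).ne').contDiffWithinAt

theorem contDiffOn_digamma : ContDiffOn ℝ ∞ digamma (Ioi 0) :=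
  contDiffOn_log_Gamma.deriv_Ioi

theorem digamma_add_one {x : ℝ} (hx : 0 < x) : digamma (x + 1) = digamma x + x⁻¹ := by
  have hx1 : 0 < x + 1 := by linarith
  have heq : (fun y => Real.log (Real.Gamma (y + 1))) =ᶠ[𝓝 x]
      fun y => Real.log y + Real.log (Real.Gamma y) := by
    filter_upwards [Ioi_mem_nhds hx] with y hy
    rw [Real.Gamma_add_one (ne_of_gt hy), Real.log_mul (ne_of_gt hy) (Real.Gamma_pos_of_pos hy).ne']
  have h := heq.deriv_eq
  rw [deriv_comp_add_const (fun y => Real.log (Real.Gamma y)), deriv_fun_add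
    (Real.differentiableAt_log hx.ne') (contDiffOn_log_Gamma.differentiableAt_of_pos hx),
    Real.deriv_log] at h
  simpa only [digamma, add_comm] using h

theorem monotoneOn_digamma : MonotoneOn digamma (Ioi 0) :=
  Real.convexOn_log_Gamma.monotoneOn_deriv fun _ hx =>
    contDiffOn_log_Gamma.differentiableAt_of_pos hx

theorem digamma_add_nat_le {x : ℝ} (hx : 0 < x) (m : ℕ) :
    digamma (x + m) ≤ digamma x + m * x⁻¹ := by
  induction m with
  | zero => simp
  | succ m ih =>
    have hm : x ≤ x + m := by simp
    have := inv_anti₀ hx hm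
    push_cast
    rw [← add_assoc, digamma_add_one (hx.trans_le hm)]
    linarith

variable {a : ℝ}

theorem tendsto_digamma_add_sub (ha : 0 ≤ a) :
    Tendsto (fun x => digamma (x + a) - digamma x) atTop (𝓝 0) := by
  obtain ⟨m, hm⟩ := exists_nat_ge a
  have h : Tendsto (fun x : ℝ => (m : ℝ) * x⁻¹) atTop (𝓝 0) := by
    simpa using tendsto_inv_atTop_zero.const_mul (m : ℝ)
  refine squeeze_zero' ?_ ?_ h <;> filter_upwards [eventually_gt_atTop 0] with x hx
  · exact sub_nonneg.2 (monotoneOn_digamma hx (mem_Ioi.2 (by positivity)) (by linarith))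
  · have h1 := monotoneOn_digamma (a := x + a) (b := x + m) (mem_Ioi.2 (by positivity))
      (mem_Ioi.2 (by positivity)) (by linarith)
    linarith [digamma_add_nat_le hx m]

theorem contDiffOn_digamma_add_sub (ha : 0 ≤ a) :
    ContDiffOn ℝ ∞ (fun x => digamma (x + a) - digamma x) (Ioi 0) :=
  (contDiffOn_digamma.comp_add_const_Ioi ha).sub contDiffOn_digamma

theorem digamma_add_sub_shift {x : ℝ} (ha : 0 ≤ a) (hx : 0 < x) :
    digamma (x + 1 + a) - digamma (x + 1) =
      digamma (x + a) - digamma x - (x⁻¹ - (x + a)⁻¹) := by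
  rw [add_right_comm, digamma_add_one hx, digamma_add_one (by positivity : 0 < x + a)]
  ring

theorem isCompletelyMonotone_inv_sub_inv (ha : 0 ≤ a) :
    IsCompletelyMonotone fun x => x⁻¹ - (x + a)⁻¹ := by
  refine (((IsCompletelyMonotone.inv_add_const le_rfl).mul
    (IsCompletelyMonotone.inv_add_const ha)).const_mul ha).congr fun x hx => ?_
  have hx : 0 < x := hx
  have : 0 < x + a := by positivity
  simp only [add_zero]
  field_simp
  ring

theorem tendsto_deriv_digamma_add_sub (ha : 0 ≤ a) :
    Tendsto (deriv fun x => digamma (x + a) - digamma x) atTop (𝓝 0) := by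
  refine tendsto_deriv_of_sub_shift (contDiffOn_digamma_add_sub ha)
    ((isCompletelyMonotone_inv_sub_inv ha).congr fun x hx => ?_) (tendsto_digamma_add_sub ha)
  simp only [digamma_add_sub_shift ha hx]
  ring

theorem tendsto_inv_add_const (c : ℝ) : Tendsto (fun x : ℝ => (x + c)⁻¹) atTop (𝓝 0) :=
  tendsto_inv_atTop_zero.comp (tendsto_atTop_add_const_right _ c tendsto_id)

/-- The difference of the two sides of the bound
`2 * (ψ (x + a) - ψ x) ≤ (a + 1) / x + (a - 1) / (x + a)` is completely monotonic. -/
theorem isCompletelyMonotone_inv_sub_digamma (ha : 1 ≤ a) :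
    IsCompletelyMonotone fun x =>
      (a + 1) * x⁻¹ + (a - 1) * (x + a)⁻¹ - 2 * (digamma (x + a) - digamma x) := by
  have ha0 : 0 ≤ a := by linarith
  have inv0 : IsCompletelyMonotone fun x => x⁻¹ := by
    simpa using IsCompletelyMonotone.inv_add_const le_rfl
  refine .of_sub_shift ?_ ?_ ?_
  · exact ((contDiffOn_const.mul inv0.1).add
      (contDiffOn_const.mul (IsCompletelyMonotone.inv_add_const ha0).1)).sub
      (contDiffOn_const.mul (contDiffOn_digamma_add_sub ha0))
  · refine ((inv0.mul (IsCompletelyMonotone.inv_add_const zero_le_one)).mul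
      ((IsCompletelyMonotone.inv_add_const ha0).mul
        (IsCompletelyMonotone.inv_add_const (by linarith : 0 ≤ a + 1)))).const_mul
      (by nlinarith : 0 ≤ a * (a ^ 2 - 1)) |>.congr fun x hx => ?_
    have hx : 0 < x := hx
    have h1 : 0 < x + a := by positivity
    have h2 : 0 < x + (a + 1) := by positivity
    have h3 : 0 < x + 1 + a := by positivity
    simp only [digamma_add_sub_shift ha0 hx]
    rw [show x + 1 + a = x + (a + 1) by ring]
    field_simp
    ring
  · simpa using ((tendsto_inv_atTop_zero.const_mul (a + 1)).add
      ((tendsto_inv_add_const a).const_mul (a - 1))).sub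
      ((tendsto_digamma_add_sub ha0).const_mul 2)

theorem isCompletelyMonotone_neg_sq_add_deriv (ha : 1 ≤ a) :
    IsCompletelyMonotone fun x => -((digamma (x + a) - digamma x) ^ 2 +
      a * deriv (fun y => digamma (y + a) - digamma y) x) := by
  have ha0 : 0 ≤ a := by linarith
  have hD := contDiffOn_digamma_add_sub ha0
  refine .of_sub_shift ((hD.pow 2).add (contDiffOn_const.mul hD.deriv_Ioi)).neg ?_ ?_
  · refine ((isCompletelyMonotone_inv_sub_inv ha0).mul
      (isCompletelyMonotone_inv_sub_digamma ha)).congr fun x hx => ?_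
    have hx : 0 < x := hx
    have hxa : 0 < x + a := by positivity
    have hderiv : deriv (fun y => digamma (y + a) - digamma y) (x + 1) =
        deriv (fun y => digamma (y + a) - digamma y) x - (-(x ^ 2)⁻¹ + ((x + a) ^ 2)⁻¹) := by
      rw [← deriv_comp_add_const]
      have heq : (fun y => digamma (y + 1 + a) - digamma (y + 1)) =ᶠ[𝓝 x]
          fun y => digamma (y + a) - digamma y - (y⁻¹ - (y + a)⁻¹) := by
        filter_upwards [Ioi_mem_nhds hx] with y hy using digamma_add_sub_shift ha0 hy
      have h1 : HasDerivAt (fun y : ℝ => y⁻¹) (-(x ^ 2)⁻¹) x := hasDerivAt_inv hx.ne'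
      have h2 : HasDerivAt (fun y : ℝ => (y + a)⁻¹) (-((x + a) ^ 2)⁻¹) x :=
        (hasDerivAt_inv hxa.ne').comp_add_const x a
      rw [heq.deriv_eq, ((hD.differentiableAt_of_pos hx).hasDerivAt.fun_sub (h1.fun_sub h2)).deriv]
      ring
    simp only [digamma_add_sub_shift ha0 hx, hderiv]
    generalize digamma (x + a) - digamma x = D
    generalize deriv (fun y => digamma (y + a) - digamma y) x = D'
    field_simp
    ring
  · simpa using (((tendsto_digamma_add_sub ha0).pow 2).add
      ((tendsto_deriv_digamma_add_sub ha0).const_mul a)).neg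

theorem neg_theta_nonneg_of_lt {s t : ℝ} (h : 1 ≤ t - s) (n : ℕ) {x : ℝ} (hx : -s < x) :
    0 ≤ (-1 : ℝ) ^ n * iteratedDeriv n (fun y : ℝ =>
      -((digamma (y + t) - digamma (y + s)) ^ 2 +
        (t - s) * (trigamma (y + t) - trigamma (y + s)))) x := by
  have key := (isCompletelyMonotone_neg_sq_add_deriv h).2 n (x + s) (mem_Ioi.2 (by linarith))
  rw [← congrFun (iteratedDeriv_comp_add_const n _ s) x] at key
  convert key using 2
  refine Filter.EventuallyEq.iteratedDeriv_eq n ?_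
  filter_upwards [Ioi_mem_nhds hx] with y hy
  have hy : -s < y := hy
  have hys : 0 < y + s := by linarith
  have hyt : 0 < y + s + (t - s) := by linarith
  rw [deriv_fun_sub (differentiableAt_comp_add_const.2 (contDiffOn_digamma.differentiableAt_of_pos hyt))
    (contDiffOn_digamma.differentiableAt_of_pos hys), deriv_comp_add_const,
    show y + s + (t - s) = y + t by ring]
  rfl

end Digamma

end

/-- For `|t - s| > 1`, the function `−Θ_{s,t}(x)`, where
`Θ_{s,t}(x) = [ψ(x+t) − ψ(x+s)]² + (t − s)[ψ'(x+t) − ψ'(x+s)]`,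
is completely monotonic on `(−min{s,t}, ∞)`. -/
theorem neg_theta_completely_monotonic (s t : ℝ) (h : |t - s| > 1) :
    ∀ n : ℕ, ∀ x ∈ Set.Ioi (-(min s t)),
      0 ≤ (-1 : ℝ) ^ n *
        iteratedDeriv n
          (fun y : ℝ =>
            -((digamma (y + t) - digamma (y + s)) ^ 2 +
              (t - s) * (trigamma (y + t) - trigamma (y + s)))) x := by
  intro n x hx
  rcases lt_abs.1 h with h | h
  · rw [min_eq_left (by linarith)] at hx
    exact neg_theta_nonneg_of_lt h.le n hx
  · rw [min_eq_right (by linarith)] at hx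
    convert neg_theta_nonneg_of_lt (s := t) (t := s) (by linarith) n hx using 4
    ring
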